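/- Let R be a Cayley–Hamilton algebra of degree n with trace tr : R → C over an algebraically closed field K of characteristic 0. Then for every positive integer ℓ, V(MD_ℓ(R/C,tr)) = V(D_ℓ(R/C,tr)) = { m ∈ maxSpec C : Σ_{V ∈ Irr_m(R)} (dim_K V)² < ℓ }, where Irr_m(R) is the set of equivalence classes of finite-dimensional irreducible representations of R annihilated by m. -/

import Mathlib

open TensorProduct

set_option synthInstance.maxHeartbeats 1600000
set_option maxHeartbeats 3200000

noncomputable section

universe u v

/-- The `m`-discriminant ideal of `R` over a central subalgebra `C`, with respect to a
trace-like map `tr : R → C`: the ideal of `C` generated by all determinants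
`det [tr (y i * y j)]` for `m`-tuples `y` of elements of `R`. -/
def discIdeal {C : Type*} {R : Type*} [CommRing C] [Ring R] [Algebra C R] (m : ℕ)
    (tr : R →ₗ[C] C) : Ideal C :=
  Ideal.span { d : C | ∃ y : Fin m → R, d = Matrix.det (Matrix.of fun i j => tr (y i * y j)) }

/-- The modified `m`-discriminant ideal of `R` over a central subalgebra `C`: the ideal of `C`
generated by all determinants `det [tr (y i * y' j)]` for pairs of `m`-tuples `y`, `y'`. -/
def mdiscIdeal {C : Type*} {R : Type*} [CommRing C] [Ring R] [Algebra C R] (m : ℕ)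
    (tr : R →ₗ[C] C) : Ideal C :=
  Ideal.span { d : C | ∃ y y' : Fin m → R, d = Matrix.det (Matrix.of fun i j => tr (y i * y' j)) }

/-- The zero locus of an ideal `I` of `C` in the maximal spectrum of `C`. -/
def maxZeroLocus {C : Type*} [CommRing C] (I : Ideal C) : Set (Ideal C) :=
  { m | m.IsMaximal ∧ I ≤ m }

/-- A bundled representation (module) of a ring `R`. -/
structure ModRep (R : Type u) [Ring R] : Type (u + 1) where
  carrier : Type u
  [acg : AddCommGroup carrier]
  [mod : Module R carrier]

attribute [instance] ModRep.acg ModRep.mod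

/-- The `K`-dimension of a module over a `K`-algebra `R` (via restriction of scalars). -/
def dimOver (K : Type v) [Field K] (R : Type u) [Ring R] [Algebra K R]
    (W : Type u) [AddCommGroup W] [Module R W] : ℕ :=
  letI : Module K W := Module.compHom W (algebraMap K R)
  Module.finrank K W

/-- Finite-dimensionality over `K` of a module over a `K`-algebra `R`. -/
def finDimOver (K : Type v) [Field K] (R : Type u) [Ring R] [Algebra K R]
    (W : Type u) [AddCommGroup W] [Module R W] : Prop :=
  letI : Module K W := Module.compHom W (algebraMap K R)
  FiniteDimensional K W

/-- The trace over `K` of the action of `a : R` on a module `W` over the `K`-algebra `R`. -/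
def traceOver (K : Type v) [Field K] (R : Type u) [Ring R] [Algebra K R]
    (W : Type u) [AddCommGroup W] [Module R W] (a : R) : K :=
  letI : Module K W := Module.compHom W (algebraMap K R)
  LinearMap.trace K W
    { toFun := fun w => a • w
      map_add' := fun v w => smul_add a v w
      map_smul' := fun k w => by
        show a • (algebraMap K R k • w) = algebraMap K R k • (a • w)
        rw [smul_smul, smul_smul, Algebra.commutes] }

def repDim (K : Type v) [Field K] {R : Type u} [Ring R] [Algebra K R] (V : ModRep R) : ℕ :=
  dimOver K R V.carrier

def repFinDim (K : Type v) [Field K] {R : Type u} [Ring R] [Algebra K R] (V : ModRep R) : Prop :=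
  finDimOver K R V.carrier

def repTrace (K : Type v) [Field K] {R : Type u} [Ring R] [Algebra K R]
    (V : ModRep R) (a : R) : K :=
  traceOver K R V.carrier a

/-- A representation of `R` is annihilated by the ideal `m` of the central subalgebra `C`. -/
def killedBy {C : Type*} {R : Type u} [CommRing C] [Ring R] [Algebra C R]
    (V : ModRep R) (m : Ideal C) : Prop :=
  ∀ z : C, z ∈ m → ∀ v : V.carrier, algebraMap C R z • v = 0

set_option linter.style.haveILetI false

/-- Extending a prescribed assignment on a linearly independent family. -/
theorem aux_exists_lin {D V ι : Type*} [DivisionRing D] [AddCommGroup V] [Module D V]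
    {v : ι → V} (hv : LinearIndependent D v) (w : ι → V) :
    ∃ f : V →ₗ[D] V, ∀ i, f (v i) = w i := by
  obtain ⟨g, hg⟩ := LinearMap.exists_extend ((Module.Basis.span hv).constr ℕ w)
  refine ⟨g, fun i => ?_⟩
  have h1 := LinearMap.congr_fun hg (Module.Basis.span hv i)
  rw [Module.Basis.constr_basis] at h1
  simpa [Module.Basis.span_apply] using h1

open Classical in
/-- Density in interpolation form. -/
theorem aux_density {R V ι : Type*} [Ring R] [AddCommGroup V] [Module R V] [IsSimpleModule R V]
    [Finite ι] {v : ι → V} (hv : LinearIndependent (Module.End R V) v) (w : ι → V) :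
    ∃ r : R, ∀ i, r • v i = w i := by
  obtain ⟨f, hf⟩ := aux_exists_lin hv w
  have := Fintype.ofFinite ι
  obtain ⟨r, hr⟩ := jacobson_density f (Finset.univ.image v)
  exact ⟨r, fun i => by rw [← hr (v i) (by simp), hf]⟩

open Classical in
theorem aux_finite_of_bound {D V : Type*} [DivisionRing D] [AddCommGroup V] [Module D V] (d : ℕ)
    (h : ∀ v : Fin (d + 1) → V, ¬ LinearIndependent D v) : Module.Finite D V := by
  have h1 : Module.rank D V ≤ (d : ℕ) := by
    apply rank_le
    intro s hs
    by_contra hlt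
    push Not at hlt
    let e : Fin (d + 1) ↪ s :=
      (Fin.castLEEmb (by simpa using hlt : d + 1 ≤ Fintype.card s)).trans
        (Fintype.equivFin s).symm.toEmbedding
    exact h _ (hs.comp e e.injective)
  exact Module.rank_lt_aleph0_iff.1 (lt_of_le_of_lt h1 (Cardinal.natCast_lt_aleph0))

/-- In a division algebra of bounded degree, some element generates its own centralizer. -/
theorem aux_max_subfield {F D : Type*} [Field F] [CharZero F] [DivisionRing D] [Algebra F D]
    (n : ℕ) (h : ∀ a : D, ∃ p : Polynomial F, p.Monic ∧ p.natDegree = n ∧ Polynomial.aeval a p = 0) :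
    ∃ a : D, ∀ c : D, a * c = c * a → c ∈ Algebra.adjoin F {a} := by
  have hint : ∀ a : D, IsIntegral F a := fun a => by
    obtain ⟨p, hp, -, h0⟩ := h a
    exact ⟨p, hp, by simpa [Polynomial.aeval_def] using h0⟩
  have hdeg : ∀ a : D, (minpoly F a).natDegree ≤ n := fun a => by
    obtain ⟨p, hp, h1, h0⟩ := h a
    rw [← h1]
    exact Polynomial.natDegree_le_natDegree (minpoly.min F a hp h0)
  obtain ⟨a, ha⟩ : ∃ a : D, ∀ b : D, (minpoly F b).natDegree ≤ (minpoly F a).natDegree := by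
    have hb : BddAbove (Set.range fun b : D => (minpoly F b).natDegree) :=
      ⟨n, by rintro _ ⟨b, rfl⟩; exact hdeg b⟩
    obtain ⟨a, ha⟩ := Nat.sSup_mem (Set.range_nonempty _) hb
    refine ⟨a, fun b => ?_⟩
    dsimp only at ha
    rw [ha]
    exact le_csSup hb ⟨b, rfl⟩
  refine ⟨a, fun c hc => ?_⟩
  let S : Subalgebra F D := Algebra.adjoin F {a, c}
  have hcomm : ∀ x ∈ ({a, c} : Set D), ∀ y ∈ ({a, c} : Set D), x * y = y * x := by
    rintro x (rfl | rfl) y (rfl | rfl) <;> simp [hc]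
  have : IsMulCommutative S := Algebra.isMulCommutative_adjoin F hcomm
  letI : CommRing S := { (inferInstance : Ring S) with mul_comm := fun x y => mul_comm' x y }
  have : Algebra.IsIntegral F S := ⟨fun x =>
    (isIntegral_algHom_iff S.val Subtype.val_injective).1 (hint x)⟩
  have : IsDomain S := inferInstance
  have hS : IsField S := isField_of_isIntegral_of_isField' (R := F) (Field.toIsField F)
  have : Algebra.FiniteType F S := (Subalgebra.fg_iff_finiteType S).1
    (Subalgebra.fg_def.2 ⟨{a, c}, Set.toFinite _, rfl⟩)
  have : Module.Finite F S := Algebra.IsIntegral.finite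
  letI : Field S := hS.toField
  obtain ⟨α, hα⟩ := Field.exists_primitive_element F S
  have haS : a ∈ S := Algebra.subset_adjoin (by simp)
  have hcS : c ∈ S := Algebra.subset_adjoin (by simp)
  let a' : S := ⟨a, haS⟩
  let c' : S := ⟨c, hcS⟩
  have e1 : Module.finrank F S = (minpoly F α).natDegree := by
    rw [← IntermediateField.adjoin.finrank (Algebra.IsIntegral.isIntegral α), hα]
    exact (IntermediateField.finrank_top' (F := F) (E := S)).symm
  have e2 : (minpoly F α).natDegree ≤ (minpoly F a').natDegree := by
    have := ha (α : D)
    rwa [← minpoly.algHom_eq S.val Subtype.val_injective α,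
      ← minpoly.algHom_eq S.val Subtype.val_injective a']
  have e3 : IntermediateField.adjoin F {a'} = ⊤ := by
    apply IntermediateField.eq_of_le_of_finrank_le le_top
    rw [IntermediateField.adjoin.finrank (Algebra.IsIntegral.isIntegral a')]
    rw [IntermediateField.finrank_top', e1]
    exact e2
  have e4 : c' ∈ (IntermediateField.adjoin F {a'}).toSubalgebra := by rw [e3]; trivial
  rw [IntermediateField.adjoin_simple_toSubalgebra_of_isAlgebraic
    (Algebra.IsIntegral.isIntegral a').isAlgebraic] at e4
  have e5 : S.val c' ∈ (Algebra.adjoin F {a'}).map S.val := ⟨c', e4, rfl⟩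
  rw [AlgHom.map_adjoin] at e5
  simpa [a', c'] using e5

open MulOpposite in
/-- A division algebra of bounded degree over a field of characteristic zero is finite
dimensional. -/
theorem aux_div_finite {F D : Type*} [Field F] [CharZero F] [DivisionRing D] [Algebra F D]
    (n : ℕ) (h : ∀ a : D, ∃ p : Polynomial F, p.Monic ∧ p.natDegree = n ∧ Polynomial.aeval a p = 0) :
    Module.Finite F D := by
  classical
  obtain ⟨a, ha⟩ := aux_max_subfield n h
  have haint : IsIntegral F a := by
    obtain ⟨p, hp, -, h0⟩ := h a
    exact ⟨p, hp, by simpa [Polynomial.aeval_def] using h0⟩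
  have haint' : IsIntegral F (op a) := by
    obtain ⟨p, hp, h0⟩ := haint
    refine ⟨p, hp, ?_⟩
    have := congrArg op h0
    rw [Polynomial.eval₂_eq_sum, Polynomial.sum] at this ⊢
    simpa [Algebra.commutes] using this
  let B : Subalgebra F Dᵐᵒᵖ := Algebra.adjoin F {op a}
  have : Module.Finite F B := Module.Finite.iff_fg.2 haint'.fg_adjoin_singleton
  have : Module.Finite F (Algebra.adjoin F {a}) := Module.Finite.iff_fg.2 haint.fg_adjoin_singleton
  letI : Module (D ⊗[F] B) D := TensorProduct.Algebra.module
  have hsm : ∀ (d : D) (b : B) (x : D), (d ⊗ₜ[F] b) • x = d * (x * unop (b : Dᵐᵒᵖ)) := by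
    intro d b x
    rw [TensorProduct.Algebra.smul_def]
    rfl
  have hleft : ∀ (d x : D), (d ⊗ₜ[F] (1 : B)) • x = d * x := by
    intro d x; rw [hsm]; simp
  have : IsSimpleModule (D ⊗[F] B) D := by
    rw [isSimpleModule_iff_toSpanSingleton_surjective]
    refine ⟨inferInstance, fun x hx y => ⟨(y * x⁻¹) ⊗ₜ 1, ?_⟩⟩
    rw [LinearMap.toSpanSingleton_apply, hleft]
    simp [hx]
  -- endomorphisms
  have hend : ∀ δ : Module.End (D ⊗[F] B) D, (∀ x, δ x = x * δ 1) ∧ δ 1 ∈ Algebra.adjoin F {a} := by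
    intro δ
    have h1 : ∀ x, δ x = x * δ 1 := fun x => by
      have := δ.map_smul (x ⊗ₜ[F] (1 : B)) 1
      rwa [hleft, hleft, mul_one] at this
    refine ⟨h1, ha _ ?_⟩
    have := δ.map_smul ((1 : D) ⊗ₜ[F] (⟨op a, Algebra.subset_adjoin rfl⟩ : B)) 1
    rw [hsm, hsm] at this
    simp only [unop_op, one_mul] at this
    rw [← this, h1 a]
  let d := Module.finrank F B
  let b := Module.finBasis F B
  have hform : ∀ e : D ⊗[F] B, ∃ y : Fin d → D, ∀ x, e • x = ∑ j, y j * (x * unop (b j : Dᵐᵒᵖ)) := by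
    intro e
    induction e using TensorProduct.induction_on with
    | zero => exact ⟨0, fun x => by rw [zero_smul (D ⊗[F] B) x]; simp⟩
    | tmul u v =>
      refine ⟨fun j => b.repr v j • u, fun x => ?_⟩
      rw [hsm]
      have hv : (v : Dᵐᵒᵖ) = ∑ j, b.repr v j • (b j : Dᵐᵒᵖ) := by
        have := congrArg (fun z : B => (z : Dᵐᵒᵖ)) (b.sum_repr v)
        simp only [AddSubmonoidClass.coe_finsetSum, SetLike.val_smul] at this
        exact this.symm
      rw [hv]
      simp [Finset.mul_sum, Finset.unop_sum, d]
    | add e₁ e₂ h₁ h₂ =>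
      obtain ⟨y₁, h₁⟩ := h₁
      obtain ⟨y₂, h₂⟩ := h₂
      refine ⟨y₁ + y₂, fun x => ?_⟩
      rw [add_smul, h₁, h₂]
      simp [add_mul, Finset.sum_add_distrib]
  have hfin : Module.Finite (Module.End (D ⊗[F] B) D) D := by
    refine aux_finite_of_bound (D := Module.End (D ⊗[F] B) D) (V := D) d ?_
    intro v hv
    let φ : (Fin d → D) →ₗ[D] (Fin (d + 1) → D) :=
      { toFun := fun y i => ∑ j, y j * (v i * unop (b j : Dᵐᵒᵖ))
        map_add' := fun y z => by ext i; simp [add_mul, Finset.sum_add_distrib]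
        map_smul' := fun k y => by ext i; simp [mul_assoc, Finset.mul_sum] }
    have hφ : Function.Surjective φ := by
      intro w
      obtain ⟨e, he⟩ := aux_density hv w
      obtain ⟨y, hy⟩ := hform e
      exact ⟨y, by ext i; rw [← he i, hy]; rfl⟩
    have := LinearMap.finrank_le_finrank_of_surjective hφ
    simp at this
  have hfg := hfin.fg_top
  obtain ⟨s, hs⟩ := hfg
  -- D is spanned over F by `x * l`
  let ψ : (s → Algebra.adjoin F {a}) →ₗ[F] D :=
    { toFun := fun l => ∑ x : s, (x : D) * (l x : D)
      map_add' := fun l l' => by simp [mul_add, Finset.sum_add_distrib]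
      map_smul' := fun k l => by simp [Finset.smul_sum] }
  apply Module.Finite.of_surjective ψ
  intro y
  have hy : y ∈ Submodule.span (Module.End (D ⊗[F] B) D) (s : Set D) := by rw [hs]; trivial
  rw [Submodule.mem_span_finset'] at hy
  obtain ⟨f, hf⟩ := hy
  refine ⟨fun x => ⟨f x 1, (hend _).2⟩, ?_⟩
  rw [← hf]
  show ∑ x : s, (x : D) * (f x 1) = _
  exact Finset.sum_congr rfl fun x _ => ((hend (f x)).1 x).symm

/-- Kaplansky: simple modules on which every ring element acts with bounded degree over a
field of scalars are finite dimensional. -/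
theorem aux_kaplansky {F R V : Type*} [Field F] [CharZero F] [Ring R] [AddCommGroup V] [Module R V]
    [Module F V] [SMulCommClass R F V] [IsSimpleModule R V] (n : ℕ)
    (hF : ∀ k : F, ∃ r : R, ∀ v : V, k • v = r • v)
    (h : ∀ r : R, ∃ p : Polynomial F, p.Monic ∧ p.natDegree = n ∧
      Polynomial.aeval (Module.toModuleEnd F V r) p = 0) : Module.Finite F V := by
  classical
  have : SMulCommClass F R V := SMulCommClass.symm _ _ _
  letI : Algebra F (Module.End R V) := Algebra.ofModule (fun _ _ _ => rfl) (fun k f g => by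
    ext v
    obtain ⟨r, hr⟩ := hF k
    show f (k • g v) = k • f (g v)
    rw [hr, hr, map_smul])
  have hsc : ∀ (k : F) (v : V), k • v = (algebraMap F (Module.End R V) k) • v := fun k v => rfl
  have : IsScalarTower F (Module.End R V) V := ⟨fun k δ v => rfl⟩
  have hpow : ∀ (r : R) (k : ℕ) (v : V), ((Module.toModuleEnd F V r) ^ k) v = r ^ k • v := by
    intro r k v
    rw [← map_pow]; rfl
  have hval : ∀ (p : Polynomial F) (r : R) (v : V),
      Polynomial.aeval (Module.toModuleEnd F V r) p v =
        ∑ i ∈ Finset.range (p.natDegree + 1), p.coeff i • (r ^ i • v) := by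
    intro p r v
    rw [Polynomial.aeval_eq_sum_range]
    simp only [LinearMap.sum_apply, LinearMap.smul_apply, hpow]
  have hV : Module.Finite (Module.End R V) V := by
    apply aux_finite_of_bound n
    intro v hv
    obtain ⟨r, hr⟩ := aux_density hv (fun i : Fin (n + 1) =>
      if hi : (i : ℕ) + 1 < n + 1 then v ⟨i + 1, hi⟩ else 0)
    obtain ⟨p, hp, hpn, h0⟩ := h r
    have hk : ∀ k (hk : k < n + 1), r ^ k • v 0 = v ⟨k, hk⟩ := by
      intro k
      induction k with
      | zero => intro _; simp
      | succ k ih =>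
        intro hk
        rw [pow_succ', mul_smul, ih (by omega), hr]
        simp only [hk, dif_pos]
    have h1 := congrArg (fun T : Module.End F V => T (v 0)) h0
    simp only [hval, hpn, LinearMap.zero_apply] at h1
    rw [← Fin.sum_univ_eq_sum_range (fun i => p.coeff i • (r ^ i • v 0))] at h1
    have h2 : ∑ i : Fin (n + 1), (algebraMap F (Module.End R V) (p.coeff i)) • v i = 0 := by
      rw [← h1]
      refine Finset.sum_congr rfl fun i _ => ?_
      rw [hk i i.2, hsc]
    have h3 := Fintype.linearIndependent_iff.1 hv _ h2 (Fin.last n)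
    have h4 : p.coeff n = 1 := by rw [← hpn]; exact hp
    simp [h4] at h3
  have : Module.Finite F (Module.End R V) := by
    apply aux_div_finite n
    intro δ
    let b := Module.finBasis (Module.End R V) V
    obtain ⟨r, hr⟩ := aux_density b.linearIndependent (fun i => δ • b i)
    obtain ⟨p, hp, hpn, h0⟩ := h r
    refine ⟨p, hp, hpn, ?_⟩
    have := IsSimpleModule.nontrivial R V
    have hne : Nonempty (Fin (Module.finrank (Module.End R V) V)) := by
      rw [← Fin.pos_iff_nonempty]; exact Module.finrank_pos
    obtain ⟨i⟩ := hne
    have hk : ∀ k : ℕ, r ^ k • b i = δ ^ k • b i := by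
      intro k
      induction k with
      | zero => simp
      | succ k ih =>
        rw [pow_succ', mul_smul, ih, pow_succ, mul_smul]
        have : r • (δ ^ k • b i) = δ ^ k • (r • b i) := smul_comm _ _ _
        rw [this, hr]
    have h1 := congrArg (fun T : Module.End F V => T (b i)) h0
    simp only [hval, LinearMap.zero_apply] at h1
    have h2 : (Polynomial.aeval δ p) • b i = 0 := by
      rw [← h1, Polynomial.aeval_eq_sum_range, Finset.sum_smul]
      refine Finset.sum_congr rfl fun j _ => ?_
      rw [hk, smul_assoc]
    exact (smul_eq_zero.1 h2).resolve_right (b.ne_zero i)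
  exact Module.Finite.trans (Module.End R V) V

/-- Residue fields of `C` are `K`. -/
theorem aux_residue {K C R : Type*} [Field K] [IsAlgClosed K] [CharZero K]
    [CommRing C] [Ring R] [Algebra K C] [Algebra K R] [Algebra C R] [IsScalarTower K C R]
    [Algebra.FiniteType K R] (n : ℕ) (hn : 0 < n) (tr : R →ₗ[C] C) (htr1 : tr 1 = (n : C))
    (hint : ∀ a : R, ∃ p : Polynomial C, p.Monic ∧ p.natDegree = n ∧ Polynomial.aeval a p = 0)
    (m : Ideal C) [hm : m.IsMaximal] :
    Function.Bijective (algebraMap K (C ⧸ m)) := by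
  classical
  letI : Field (C ⧸ m) := Ideal.Quotient.field m
  have : CharZero (C ⧸ m) := charZero_of_injective_algebraMap (algebraMap K (C ⧸ m)).injective
  let J : Ideal R := m.map (algebraMap C R)
  have hJ : ∀ z ∈ m, ∀ r : R, z • r ∈ J := by
    intro z hz r
    rw [Algebra.smul_def, Algebra.commutes]
    exact J.mul_mem_left _ (Ideal.mem_map_of_mem _ hz)
  have htrJ : ∀ x ∈ J, tr x ∈ m := by
    intro x hx
    refine Submodule.span_induction (p := fun x _ => ∀ r : R, tr (r * x) ∈ m)
      ?_ ?_ ?_ ?_ hx 1 |> fun h => by simpa using h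
    · rintro _ ⟨z, hz, rfl⟩ r
      rw [← Algebra.commutes, ← Algebra.smul_def, map_smul]
      exact m.mul_mem_right _ hz
    · intro r; simp
    · intro x y _ _ hx hy r
      rw [mul_add, map_add]; exact m.add_mem (hx r) (hy r)
    · intro a x _ hx r
      rw [smul_eq_mul, ← mul_assoc]; exact hx _
  have hJtop : J ≠ ⊤ := by
    intro h
    have h1 := htrJ 1 (h ▸ trivial)
    rw [htr1] at h1
    have h2 : ((n : C ⧸ m)) = 0 := by
      rw [← map_natCast (Ideal.Quotient.mk m)]
      exact Ideal.Quotient.eq_zero_iff_mem.2 h1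
    rw [Nat.cast_eq_zero] at h2
    omega
  obtain ⟨M, hM, hJM⟩ := Ideal.exists_le_maximal J hJtop
  have : IsSimpleModule R (R ⧸ M) := isSimpleModule_iff_isCoatom.2 hM.out
  have htors : Module.IsTorsionBySet C (R ⧸ M) (m : Set C) := by
    rintro v ⟨z, hz⟩
    obtain ⟨r, rfl⟩ := Submodule.Quotient.mk_surjective M v
    show z • (Submodule.Quotient.mk r : R ⧸ M) = 0
    rw [← Submodule.Quotient.mk_smul, Submodule.Quotient.mk_eq_zero]
    exact hJM (hJ z hz r)
  letI : Module (C ⧸ m) (R ⧸ M) := htors.module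
  have hsm : ∀ (z : C) (v : R ⧸ M), (Ideal.Quotient.mk m z) • v = z • v := fun z v => rfl
  have hsm' : ∀ (z : C) (v : R ⧸ M), z • v = algebraMap C R z • v := fun z v =>
    (algebraMap_smul R z v).symm
  have : SMulCommClass R (C ⧸ m) (R ⧸ M) := ⟨fun r z v => by
    obtain ⟨z, rfl⟩ := Ideal.Quotient.mk_surjective z
    rw [hsm, hsm, hsm', hsm', smul_smul, smul_smul, Algebra.commutes]⟩
  have hfin : Module.Finite (C ⧸ m) (R ⧸ M) := by
    refine aux_kaplansky (R := R) n ?_ ?_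
    · intro k
      obtain ⟨z, rfl⟩ := Ideal.Quotient.mk_surjective k
      exact ⟨algebraMap C R z, fun v => by rw [hsm, hsm']⟩
    · intro r
      obtain ⟨p, hp, hpn, h0⟩ := hint r
      refine ⟨p.map (Ideal.Quotient.mk m), hp.map _, by rw [hp.natDegree_map, hpn], ?_⟩
      ext v
      have hpow : ∀ k : ℕ, ((Module.toModuleEnd (C ⧸ m) (R ⧸ M) r) ^ k) v = r ^ k • v := by
        intro k
        rw [← map_pow]; rfl
      rw [Polynomial.aeval_eq_sum_range, hp.natDegree_map, LinearMap.sum_apply]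
      simp only [LinearMap.smul_apply, hpow, Polynomial.coeff_map, hsm, LinearMap.zero_apply]
      have h1 := congrArg (fun x : R => x • v) h0
      simp only [Polynomial.aeval_eq_sum_range, Finset.sum_smul, zero_smul] at h1
      rw [← h1]
      exact Finset.sum_congr rfl fun i _ => by rw [smul_assoc]
  let b := Module.finBasis (C ⧸ m) (R ⧸ M)
  have : Nontrivial (R ⧸ M) := IsSimpleModule.nontrivial R (R ⧸ M)
  obtain ⟨i₀⟩ : Nonempty (Fin (Module.finrank (C ⧸ m) (R ⧸ M))) := by
    rw [← Fin.pos_iff_nonempty]; exact Module.finrank_pos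
  obtain ⟨s, hs⟩ := (Algebra.FiniteType.out : (⊤ : Subalgebra K R).FG)
  let g : Finset (C ⧸ m) := (s ×ˢ (Finset.univ ×ˢ Finset.univ)).image
    fun q => b.repr (q.1 • b q.2.1) q.2.2
  let S : Subalgebra K (C ⧸ m) := Algebra.adjoin K (g : Set (C ⧸ m))
  have hcoef : ∀ r : R, ∀ i j, b.repr (r • b j) i ∈ S := by
    intro r
    have hr : r ∈ Algebra.adjoin K (s : Set R) := by rw [hs]; trivial
    induction hr using Algebra.adjoin_induction with
    | mem x hx =>
      intro i j
      apply Algebra.subset_adjoin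
      simp only [g, Finset.coe_image, Set.mem_image]
      exact ⟨(x, j, i), by simpa using hx, rfl⟩
    | algebraMap k =>
      intro i j
      rw [IsScalarTower.algebraMap_apply K C R, ← hsm', ← hsm, map_smul, Finsupp.smul_apply,
        Module.Basis.repr_self, smul_eq_mul]
      refine S.mul_mem (S.algebraMap_mem k) ?_
      rw [Finsupp.single_apply]
      split_ifs
      · exact S.one_mem
      · exact S.zero_mem
    | add x y _ _ hx hy =>
      intro i j
      rw [add_smul, map_add, Finsupp.add_apply]
      exact S.add_mem (hx i j) (hy i j)
    | mul x y _ _ hx hy =>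
      intro i j
      rw [mul_smul, ← b.sum_repr (y • b j), Finset.smul_sum, map_sum, Finsupp.finsetSum_apply]
      refine S.sum_mem fun l _ => ?_
      rw [smul_comm, map_smul, Finsupp.smul_apply, smul_eq_mul]
      exact S.mul_mem (hy l j) (hx i l)
  have hStop : S = ⊤ := by
    rw [eq_top_iff]
    intro z _
    obtain ⟨z, rfl⟩ := Ideal.Quotient.mk_surjective z
    have := hcoef (algebraMap C R z) i₀ i₀
    rw [← hsm', ← hsm, map_smul, Finsupp.smul_apply, Module.Basis.repr_self,
      Finsupp.single_eq_same, smul_eq_mul, mul_one] at this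
    exact this
  have : Algebra.FiniteType K (C ⧸ m) := ⟨⟨g, hStop⟩⟩
  have : Module.Finite K (C ⧸ m) := finite_of_finite_type_of_isJacobsonRing K (C ⧸ m)
  exact IsAlgClosed.algebraMap_bijective_of_isIntegral

section core
variable {K R : Type u} [Field K] [CharZero K] [Ring R] [Algebra K R]

/-- Nilpotent characteristic polynomial when all power traces vanish. -/
theorem aux_coef_zero (T : R →ₗ[K] K) (d : ℕ → R → K)
    (hdrec : ∀ i : ℕ, 1 ≤ i → ∀ a : R,
      (i : K) * d i a = ∑ j ∈ Finset.Icc 1 i, (-1 : K) ^ (j - 1) * d (i - j) a * T (a ^ j))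
    (a : R) (h : ∀ j, 1 ≤ j → T (a ^ j) = 0) (i : ℕ) (hi : 1 ≤ i) : d i a = 0 := by
  have h1 := hdrec i hi a
  rw [Finset.sum_eq_zero] at h1
  · have : (i : K) ≠ 0 := by exact_mod_cast (by omega : i ≠ 0)
    exact (mul_eq_zero.1 h1).resolve_left this
  · intro j hj
    rw [h j (Finset.mem_Icc.1 hj).1, mul_zero]

theorem aux_pow_mem (J : Ideal R) (n : ℕ) (T : R →ₗ[K] K) (d : ℕ → R → K)
    (hd0 : ∀ a, d 0 a = 1)
    (hdrec : ∀ i : ℕ, 1 ≤ i → ∀ a : R,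
      (i : K) * d i a = ∑ j ∈ Finset.Icc 1 i, (-1 : K) ^ (j - 1) * d (i - j) a * T (a ^ j))
    (hCH : ∀ a : R, ∑ i ∈ Finset.range (n + 1), ((-1 : K) ^ i * d i a) • a ^ (n - i) ∈ J)
    (a : R) (h : ∀ j, 1 ≤ j → T (a ^ j) = 0) : a ^ n ∈ J := by
  have h1 := hCH a
  rw [Finset.sum_range_succ', Finset.sum_eq_zero] at h1
  · simpa [hd0] using h1
  · intro i _
    rw [aux_coef_zero T d hdrec a h (i + 1) (by omega)]
    simp

theorem aux_trace_nilp_step (J : Ideal R) (n : ℕ) (hn : 0 < n) (T : R →ₗ[K] K)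
    (hJ2 : ∀ x ∈ J, ∀ r, x * r ∈ J)
    (hTJ : ∀ x ∈ J, T x = 0) (hT1 : T 1 = n) (d : ℕ → R → K) (hd0 : ∀ a, d 0 a = 1)
    (hdrec : ∀ i : ℕ, 1 ≤ i → ∀ a : R,
      (i : K) * d i a = ∑ j ∈ Finset.Icc 1 i, (-1 : K) ^ (j - 1) * d (i - j) a * T (a ^ j))
    (hCH : ∀ a : R, ∑ i ∈ Finset.range (n + 1), ((-1 : K) ^ i * d i a) • a ^ (n - i) ∈ J)
    (b : R) (k : ℕ) (hk : b ^ k ∈ J) (h : ∀ j, 2 ≤ j → T (b ^ j) = 0) : T b = 0 := by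
  have hd : ∀ i, (i.factorial : K) * d i b = (T b) ^ i := by
    intro i
    induction i with
    | zero => simp [hd0]
    | succ i ih =>
      have h1 := hdrec (i + 1) (by omega) b
      rw [Finset.sum_eq_single_of_mem 1 (by simp)] at h1
      · simp only [tsub_self, pow_zero, one_mul, pow_one, Nat.add_sub_cancel] at h1
        rw [Nat.factorial_succ, Nat.cast_mul, mul_comm ((i + 1 : ℕ) : K), mul_assoc, h1,
          ← mul_assoc, ih, pow_succ]
      · intro j hj hj1
        rw [h j (by have := (Finset.mem_Icc.1 hj).1; omega), mul_zero]
  have h2 := hCH b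
  rw [Finset.sum_range_succ, Nat.sub_self, pow_zero] at h2
  obtain ⟨w, hw, hwc⟩ : ∃ w : R, ∑ i ∈ Finset.range n, ((-1 : K) ^ i * d i b) • b ^ (n - i) = b * w
      ∧ Commute b w := by
    refine ⟨∑ i ∈ Finset.range n, ((-1 : K) ^ i * d i b) • b ^ (n - i - 1), ?_, ?_⟩
    · rw [Finset.mul_sum]
      refine Finset.sum_congr rfl fun i hi => ?_
      rw [mul_smul_comm, ← pow_succ']
      congr 2
      have := Finset.mem_range.1 hi; omega
    · exact Commute.sum_right _ _ _ fun i _ => ((Commute.refl b).pow_right _).smul_right _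
  rw [hw] at h2
  set e : K := (-1 : K) ^ n * d n b with he
  -- `(-e)^k - (b w)^k ∈ J`
  have h3 : (e ^ k) • (1 : R) ∈ J := by
    have hc : Commute (b * w) (-(e • (1 : R))) := by
      apply Commute.neg_right
      exact (Commute.one_right _).smul_right _
    have h4 := hc.mul_geom_sum₂ k
    have h5 : (b * w) ^ k ∈ J := by
      rw [hwc.mul_pow]; exact hJ2 _ hk _
    have h6 : (b * w) ^ k - (-(e • (1 : R))) ^ k ∈ J := by
      rw [← h4, sub_neg_eq_add]
      exact hJ2 _ h2 _
    have h7 := J.sub_mem h5 h6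
    rw [sub_sub_cancel, neg_pow, smul_pow, one_pow] at h7
    have h8 := J.mul_mem_left ((-1) ^ k) h7
    rwa [← mul_assoc, ← (Commute.refl (-1 : R)).mul_pow, neg_one_mul, neg_neg, one_pow, one_mul] at h8
  have h4 := hTJ _ h3
  rw [map_smul, hT1, smul_eq_mul] at h4
  have hn0 : (n : K) ≠ 0 := by exact_mod_cast hn.ne'
  have h5 : e = 0 := by
    have := (mul_eq_zero.1 h4).resolve_right hn0
    exact eq_zero_of_pow_eq_zero this
  have h6 : d n b = 0 := by
    have : (-1 : K) ^ n ≠ 0 := pow_ne_zero _ (by simp)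
    exact (mul_eq_zero.1 h5).resolve_left this
  have h7 := hd n
  rw [h6, mul_zero] at h7
  exact eq_zero_of_pow_eq_zero h7.symm

theorem aux_trace_nilp (J : Ideal R) (n : ℕ) (hn : 0 < n) (T : R →ₗ[K] K)
    (hJ2 : ∀ x ∈ J, ∀ r, x * r ∈ J)
    (hTJ : ∀ x ∈ J, T x = 0) (hT1 : T 1 = n) (d : ℕ → R → K) (hd0 : ∀ a, d 0 a = 1)
    (hdrec : ∀ i : ℕ, 1 ≤ i → ∀ a : R,
      (i : K) * d i a = ∑ j ∈ Finset.Icc 1 i, (-1 : K) ^ (j - 1) * d (i - j) a * T (a ^ j))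
    (hCH : ∀ a : R, ∑ i ∈ Finset.range (n + 1), ((-1 : K) ^ i * d i a) • a ^ (n - i) ∈ J)
    (a : R) (k : ℕ) (hk : a ^ k ∈ J) : T a = 0 := by
  have hge : ∀ j, k ≤ j → a ^ j ∈ J := fun j hj => by
    rw [← Nat.add_sub_cancel' hj, pow_add]; exact hJ2 _ hk _
  have key : ∀ s j, 1 ≤ j → k ≤ j + s → T (a ^ j) = 0 := by
    intro s
    induction s with
    | zero => intro j _ hj; exact hTJ _ (hge j hj)
    | succ s ih =>
      intro j hj1 hj
      refine aux_trace_nilp_step J n hn T hJ2 hTJ hT1 d hd0 hdrec hCH (a ^ j) k ?_ ?_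
      · rw [← pow_mul]; exact hge _ (Nat.le_mul_of_pos_left k hj1)
      · intro i hi
        rw [← pow_mul]
        apply ih
        · exact Nat.mul_pos hj1 (by omega)
        · have : j * 2 ≤ j * i := Nat.mul_le_mul_left j hi
          omega
  simpa using key k 1 le_rfl (by omega)

/-- Monic polynomial relation from the Cayley–Hamilton identity. -/
theorem aux_monic {C R : Type*} [CommRing C] [Ring R] [Algebra C R] [Nontrivial C] (n : ℕ)
    (f : ℕ → C) (hf : f 0 = 1) (a : R) : ∃ p : Polynomial C, p.Monic ∧ p.natDegree = n ∧
      Polynomial.aeval a p = ∑ i ∈ Finset.range (n + 1), (f i) • a ^ (n - i) := by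
  refine ⟨Polynomial.X ^ n + ∑ i ∈ Finset.range n,
    Polynomial.C (f (i + 1)) * Polynomial.X ^ (n - (i + 1)), ?_, ?_, ?_⟩
  · apply Polynomial.monic_X_pow_add
    refine (Polynomial.degree_sum_le _ _).trans_lt ?_
    rw [Finset.sup_lt_iff (by exact WithBot.bot_lt_coe n)]
    intro i hi
    refine (Polynomial.degree_C_mul_X_pow_le _ _).trans_lt ?_
    have := Finset.mem_range.1 hi
    exact_mod_cast (by omega : n - (i + 1) < n)
  · apply Polynomial.natDegree_eq_of_degree_eq_some
    rw [Polynomial.degree_add_eq_left_of_degree_lt, Polynomial.degree_X_pow]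
    rw [Polynomial.degree_X_pow]
    refine (Polynomial.degree_sum_le _ _).trans_lt ?_
    rw [Finset.sup_lt_iff (by exact WithBot.bot_lt_coe n)]
    intro i hi
    refine (Polynomial.degree_C_mul_X_pow_le _ _).trans_lt ?_
    have := Finset.mem_range.1 hi
    exact_mod_cast (by omega : n - (i + 1) < n)
  · rw [Finset.sum_range_succ']
    simp [hf, Algebra.smul_def, add_comm]

/-- The radical of the trace form kills simple modules. -/
theorem aux_rad_kills (J : Ideal R) (n : ℕ) (T : R →ₗ[K] K) (d : ℕ → R → K)
    (hd0 : ∀ a, d 0 a = 1)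
    (hdrec : ∀ i : ℕ, 1 ≤ i → ∀ a : R,
      (i : K) * d i a = ∑ j ∈ Finset.Icc 1 i, (-1 : K) ^ (j - 1) * d (i - j) a * T (a ^ j))
    (hCH : ∀ a : R, ∑ i ∈ Finset.range (n + 1), ((-1 : K) ^ i * d i a) • a ^ (n - i) ∈ J)
    (x : R) (hx : ∀ y, T (y * x) = 0) (V : Type*) [AddCommGroup V] [Module R V]
    [IsSimpleModule R V] (hV : ∀ z ∈ J, ∀ v : V, z • v = 0) (v : V) : x • v = 0 := by
  by_contra hne
  obtain ⟨y, hy⟩ := IsSimpleModule.toSpanSingleton_surjective R hne v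
  rw [LinearMap.toSpanSingleton_apply, smul_smul] at hy
  have h1 : (y * x) ^ n ∈ J := by
    refine aux_pow_mem J n T d hd0 hdrec hCH _ fun j hj => ?_
    obtain ⟨i, rfl⟩ : ∃ i, j = i + 1 := ⟨j - 1, by omega⟩
    rw [pow_succ, ← mul_assoc]; exact hx _
  have h2 : ∀ k : ℕ, (y * x) ^ k • v = v := by
    intro k
    induction k with
    | zero => simp
    | succ k ih => rw [pow_succ, mul_smul, hy, ih]
  have h3 := hV _ h1 v
  rw [h2] at h3
  exact hne (by rw [h3, smul_zero])

/-- Elements killing all simple modules are in the radical of the trace form. -/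
theorem aux_kills_rad (J : Ideal R) (n : ℕ) (hn : 0 < n) (T : R →ₗ[K] K)
    (hJ2 : ∀ x ∈ J, ∀ r, x * r ∈ J)
    (hTJ : ∀ x ∈ J, T x = 0) (hT1 : T 1 = n) (d : ℕ → R → K) (hd0 : ∀ a, d 0 a = 1)
    (hdrec : ∀ i : ℕ, 1 ≤ i → ∀ a : R,
      (i : K) * d i a = ∑ j ∈ Finset.Icc 1 i, (-1 : K) ^ (j - 1) * d (i - j) a * T (a ^ j))
    (hCH : ∀ a : R, ∑ i ∈ Finset.range (n + 1), ((-1 : K) ^ i * d i a) • a ^ (n - i) ∈ J)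
    (x : R) (hx : ∀ (V : Type u) [AddCommGroup V] [Module R V], IsSimpleModule R V →
      (∀ z ∈ J, ∀ v : V, z • v = 0) → ∀ v : V, x • v = 0) (y : R) : T (y * x) = 0 := by
  obtain ⟨p, hp, hpn, hpa⟩ := aux_monic n (fun i => (-1 : K) ^ i * d i (y * x))
    (by simp [hd0]) (y * x)
  have hpJ : Polynomial.aeval (y * x) p ∈ J := by rw [hpa]; exact hCH _
  set a := y * x with ha
  obtain ⟨q, hq, hq0⟩ := Polynomial.exists_eq_pow_rootMultiplicity_mul_and_not_dvd p hp.ne_zero 0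
  rw [Polynomial.C_0, sub_zero] at hq hq0
  set k := Polynomial.rootMultiplicity 0 p
  refine aux_trace_nilp J n hn T hJ2 hTJ hT1 d hd0 hdrec hCH a k ?_
  have hq00 : q.coeff 0 ≠ 0 := by rwa [Ne, ← Polynomial.X_dvd_iff]
  have hI : J ⊔ Ideal.span {Polynomial.aeval a q} = ⊤ := by
    by_contra hne
    obtain ⟨M, hM, hIM⟩ := Ideal.exists_le_maximal _ hne
    have : IsSimpleModule R (R ⧸ M) := isSimpleModule_iff_isCoatom.2 hM.out
    have hkill : ∀ v : R ⧸ M, x • v = 0 := by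
      refine hx (R ⧸ M) this fun z hz v => ?_
      obtain ⟨r, rfl⟩ := Submodule.Quotient.mk_surjective M v
      rw [← Submodule.Quotient.mk_smul, Submodule.Quotient.mk_eq_zero]
      exact hIM (Ideal.mem_sup_left (hJ2 z hz r))
    have h1 : x ∈ M := by
      have := hkill (Submodule.Quotient.mk 1)
      rw [← Submodule.Quotient.mk_smul, Submodule.Quotient.mk_eq_zero] at this
      simpa using this
    have h2 : Polynomial.aeval a q ∈ M :=
      hIM (Ideal.mem_sup_right (Ideal.subset_span rfl))
    rw [← Polynomial.divX_mul_X_add q, map_add, map_mul, Polynomial.aeval_X,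
      Polynomial.aeval_C] at h2
    have h3 : algebraMap K R (q.coeff 0) ∈ M := by
      refine (M.add_mem_iff_right ?_).1 h2
      rw [ha, ← mul_assoc]
      exact M.mul_mem_left _ h1
    have h4 := M.mul_mem_left (algebraMap K R (q.coeff 0)⁻¹) h3
    rw [← map_mul, inv_mul_cancel₀ hq00, map_one] at h4
    exact hM.ne_top ((Ideal.eq_top_iff_one M).2 h4)
  have h1 : (1 : R) ∈ J ⊔ Ideal.span {Polynomial.aeval a q} := by rw [hI]; trivial
  obtain ⟨j, hj, w, hw, hjw⟩ := Submodule.mem_sup.1 h1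
  obtain ⟨u, rfl⟩ := Ideal.mem_span_singleton'.1 hw
  have h2 : a ^ k = j * a ^ k + u * Polynomial.aeval a p := by
    conv_lhs => rw [← one_mul (a ^ k), ← hjw, add_mul, mul_assoc]
    rw [hq, mul_comm _ q, map_mul, map_pow, Polynomial.aeval_X]
  rw [h2]
  exact J.add_mem (hJ2 _ hj _) (J.mul_mem_left _ hpJ)

end core

/-- Joint density for pairwise non-isomorphic simple modules. -/
theorem aux_surj {K R ι : Type*} [Field K] [IsAlgClosed K] [Ring R] [Algebra K R] [Finite ι]
    (V : ι → Type*) [∀ i, AddCommGroup (V i)] [∀ i, Module R (V i)] [∀ i, Module K (V i)]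
    [∀ i, IsScalarTower K R (V i)] [∀ i, IsSimpleModule R (V i)] [∀ i, Module.Finite K (V i)]
    (hne : ∀ i j, i ≠ j → ¬ Nonempty (V i ≃ₗ[R] V j)) (f : ∀ i, V i →ₗ[K] V i) :
    ∃ r : R, ∀ i (v : V i), r • v = f i v := by
  classical
  have hscal : ∀ δ : Module.End R (∀ i, V i), ∃ l : ι → K, ∀ w i, δ w i = l i • w i := by
    intro δ
    have h0 : ∀ i j, i ≠ j → ∀ v : V i, δ (Pi.single i v) j = 0 := by
      intro i j hij v
      let g : V i →ₗ[R] V j := LinearMap.proj j ∘ₗ δ ∘ₗ LinearMap.single R V i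
      rcases LinearMap.bijective_or_eq_zero g with hb | hz
      · exact absurd ⟨LinearEquiv.ofBijective g hb⟩ (hne i j hij)
      · exact LinearMap.congr_fun hz v
    have h1 : ∀ i, ∃ l : K, ∀ v : V i, δ (Pi.single i v) i = l • v := by
      intro i
      let g : Module.End R (V i) := LinearMap.proj i ∘ₗ δ ∘ₗ LinearMap.single R V i
      obtain ⟨l, hl⟩ := (IsSimpleModule.algebraMap_end_bijective_of_isAlgClosed
        (A := R) (V := V i) K).2 g
      exact ⟨l, fun v => (LinearMap.congr_fun hl v).symm⟩
    choose l hl using h1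
    refine ⟨l, fun w i => ?_⟩
    have := Fintype.ofFinite ι
    conv_lhs => rw [← Finset.univ_sum_single w]
    rw [map_sum, Finset.sum_apply, Finset.sum_eq_single i, hl]
    · intro j _ hj; exact h0 j i hj _
    · simp
  let F : Module.End (Module.End R (∀ i, V i)) (∀ i, V i) :=
    { toFun := fun w i => f i (w i)
      map_add' := fun w w' => by ext i; simp
      map_smul' := fun δ w => by
        ext i
        obtain ⟨l, hl⟩ := hscal δ
        simp only [Module.End.smul_def, RingHom.id_apply, hl, map_smul] }
  have := Fintype.ofFinite ι
  obtain ⟨s, hs⟩ := (inferInstance : Module.Finite K (∀ i, V i)).fg_top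
  obtain ⟨r, hr⟩ := jacobson_density F s
  refine ⟨r, fun i v => ?_⟩
  have key : ∀ w : (∀ i, V i), F w = r • w := by
    intro w
    have hw : w ∈ Submodule.span K (s : Set (∀ i, V i)) := by rw [hs]; trivial
    induction hw using Submodule.span_induction with
    | mem x hx => exact hr x hx
    | zero => simp
    | add x y _ _ hx hy => rw [map_add, hx, hy, smul_add]
    | smul k x _ hx =>
      rw [smul_comm r k x, ← hx]
      ext i
      simp [F]
  have := congrFun (key (Pi.single i v)) i
  simpa [F] using this.symm

/-- Gram determinants. -/
theorem aux_gram {K R W : Type*} [Field K] [CharZero K] [AddCommGroup R] [Module K R]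
    [AddCommGroup W] [Module K W] [Module.Finite K W] (B : LinearMap.BilinForm K R)
    (hB : ∀ x y, B x y = B y x) (Φ : R →ₗ[K] W) (hΦ : Function.Surjective Φ)
    (hker : ∀ x, Φ x = 0 ↔ ∀ y, B x y = 0) (l : ℕ) :
    ((∃ y : Fin l → R, Matrix.det (Matrix.of fun i j => B (y i) (y j)) ≠ 0) ↔
      l ≤ Module.finrank K W) ∧
    ((∃ y y' : Fin l → R, Matrix.det (Matrix.of fun i j => B (y i) (y' j)) ≠ 0) ↔
      l ≤ Module.finrank K W) := by
  have hle : ∀ y y' : Fin l → R, Matrix.det (Matrix.of fun i j => B (y i) (y' j)) ≠ 0 →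
      l ≤ Module.finrank K W := by
    intro y y' hdet
    have hli : LinearIndependent K (fun i => Φ (y i)) := by
      rw [Fintype.linearIndependent_iff]
      intro g hg
      have h1 : Φ (∑ i, g i • y i) = 0 := by simpa using hg
      rw [hker] at h1
      have h2 : Matrix.vecMul g (Matrix.of fun i j => B (y i) (y' j)) = 0 := by
        ext j
        have := h1 (y' j)
        simpa [Matrix.vecMul, dotProduct] using this
      exact congrFun (Matrix.eq_zero_of_vecMul_eq_zero hdet h2)
    simpa using hli.fintype_card_le_finrank
  have hge : l ≤ Module.finrank K W →
      ∃ y : Fin l → R, Matrix.det (Matrix.of fun i j => B (y i) (y j)) ≠ 0 := by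
    intro hl
    obtain ⟨σ, hσ⟩ := Φ.exists_rightInverse_of_surjective (LinearMap.range_eq_top.2 hΦ)
    have hσ' : ∀ w, Φ (σ w) = w := fun w => LinearMap.congr_fun hσ w
    let B' : LinearMap.BilinForm K W := B.compl₁₂ σ σ
    have hB' : ∀ w w', B' w w' = B (σ w) (σ w') := fun _ _ => rfl
    have hsymm : LinearMap.IsSymm B' := ⟨fun w w' => by simp [hB', hB (σ w)]⟩
    letI : Invertible (2 : K) := invertibleOfNonzero two_ne_zero
    obtain ⟨v, hv⟩ := LinearMap.BilinForm.exists_orthogonal_basis hsymm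
    have hnz : ∀ i, B' (v i) (v i) ≠ 0 := by
      intro i h0
      have h1 : ∀ w, B' (v i) w = 0 := by
        intro w
        have : B' (v i) = 0 := v.ext fun j => by
          by_cases hij : i = j
          · subst hij; simpa using h0
          · exact hv hij
        rw [this]; rfl
      have h2 : Φ (σ (v i)) = 0 := by
        rw [hker]
        intro y
        have h3 : Φ (y - σ (Φ y)) = 0 := by simp [hσ']
        have h4 := (hker _).1 h3 (σ (v i))
        rw [hB, map_sub, ← hB', h1, sub_zero] at h4
        exact h4
      rw [hσ'] at h2
      exact v.ne_zero i h2
    refine ⟨fun i => σ (v (Fin.castLE hl i)), ?_⟩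
    have : (Matrix.of fun i j => B (σ (v (Fin.castLE hl i))) (σ (v (Fin.castLE hl j)))) =
        Matrix.diagonal fun i : Fin l => B' (v (Fin.castLE hl i)) (v (Fin.castLE hl i)) := by
      ext i j
      by_cases hij : i = j
      · subst hij; simp [hB']
      · rw [Matrix.diagonal_apply_ne _ hij]
        exact hv (fun h => hij (Fin.castLE_injective hl h))
    rw [this, Matrix.det_diagonal]
    exact Finset.prod_ne_zero_iff.2 fun i _ => hnz _
  refine ⟨⟨fun ⟨y, hy⟩ => hle y y hy, hge⟩, ⟨fun ⟨y, y', hy⟩ => hle y y' hy, fun h => ?_⟩⟩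
  obtain ⟨y, hy⟩ := hge h
  exact ⟨y, y, hy⟩

/-- Simple modules killed by `J` are finite dimensional. -/
theorem aux_findim {K R : Type*} [Field K] [CharZero K] [Ring R] [Algebra K R]
    (J : Ideal R) (n : ℕ) (d : ℕ → R → K) (hd0 : ∀ a, d 0 a = 1)
    (hCH : ∀ a : R, ∑ i ∈ Finset.range (n + 1), ((-1 : K) ^ i * d i a) • a ^ (n - i) ∈ J)
    (V : Type*) [AddCommGroup V] [Module R V] [Module K V] [IsScalarTower K R V]
    [IsSimpleModule R V] (hV : ∀ z ∈ J, ∀ v : V, z • v = 0) : Module.Finite K V := by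
  refine aux_kaplansky (R := R) n (fun k => ⟨algebraMap K R k, fun v => by simp⟩) fun r => ?_
  obtain ⟨p, hp, hpn, hpa⟩ := aux_monic n (fun i => (-1 : K) ^ i * d i r) (by simp [hd0]) r
  refine ⟨p, hp, hpn, ?_⟩
  ext v
  have hpow : ∀ k : ℕ, ((Module.toModuleEnd K V r) ^ k) v = r ^ k • v := by
    intro k
    rw [← map_pow]; rfl
  have h1 : Polynomial.aeval r p • v = 0 := hV _ (by rw [hpa]; exact hCH r) v
  rw [Polynomial.aeval_eq_sum_range, LinearMap.sum_apply]
  simp only [LinearMap.smul_apply, hpow, LinearMap.zero_apply]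
  simp only [Polynomial.aeval_eq_sum_range, Finset.sum_smul] at h1
  rw [← h1]
  exact Finset.sum_congr rfl fun i _ => by rw [smul_assoc]

/-- The number of pairwise non-isomorphic simple modules is at most `n`. -/
theorem aux_bound {K R : Type*} [Field K] [IsAlgClosed K] [CharZero K] [Ring R] [Algebra K R]
    (J : Ideal R) (n : ℕ) (d : ℕ → R → K) (hd0 : ∀ a, d 0 a = 1)
    (hCH : ∀ a : R, ∑ i ∈ Finset.range (n + 1), ((-1 : K) ^ i * d i a) • a ^ (n - i) ∈ J)
    (t : ℕ) (V : Fin t → Type*) [∀ i, AddCommGroup (V i)] [∀ i, Module R (V i)]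
    [∀ i, Module K (V i)] [∀ i, IsScalarTower K R (V i)] [∀ i, IsSimpleModule R (V i)]
    (hV : ∀ i, ∀ z ∈ J, ∀ v : V i, z • v = 0)
    (hne : ∀ i j, i ≠ j → ¬ Nonempty (V i ≃ₗ[R] V j)) : t ≤ n := by
  classical
  have : ∀ i, Module.Finite K (V i) := fun i => aux_findim J n d hd0 hCH (V i) (hV i)
  obtain ⟨r, hr⟩ := aux_surj (K := K) V hne (fun i => ((i : ℕ) : K) • LinearMap.id)
  obtain ⟨p, hp, hpn, hpa⟩ := aux_monic n (fun i => (-1 : K) ^ i * d i r) (by simp [hd0]) r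
  have hroot : ∀ i : Fin t, p.eval ((i : ℕ) : K) = 0 := by
    intro i
    have := IsSimpleModule.nontrivial R (V i)
    obtain ⟨v, hv⟩ := exists_ne (0 : V i)
    have h1 : Polynomial.aeval r p • v = 0 := hV i _ (by rw [hpa]; exact hCH r) v
    have hk : ∀ k : ℕ, r ^ k • v = (((i : ℕ) : K) ^ k) • v := by
      intro k
      induction k with
      | zero => simp
      | succ k ih =>
        rw [pow_succ', mul_smul, ih, hr, LinearMap.smul_apply, LinearMap.id_apply, smul_smul,
          pow_succ']
    rw [Polynomial.aeval_eq_sum_range, Finset.sum_smul] at h1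
    have h2 : (p.eval ((i : ℕ) : K)) • v = 0 := by
      rw [← h1, Polynomial.eval_eq_sum_range, Finset.sum_smul]
      refine Finset.sum_congr rfl fun j _ => ?_
      rw [smul_assoc, hk, smul_smul]
    exact (smul_eq_zero.1 h2).resolve_right hv
  have hinj : Function.Injective (fun i : Fin t => ((i : ℕ) : K)) := fun i j h =>
    Fin.ext (Nat.cast_injective h)
  have hsub : (Finset.univ.image fun i : Fin t => ((i : ℕ) : K)) ⊆ p.roots.toFinset := by
    intro z hz
    obtain ⟨i, -, rfl⟩ := Finset.mem_image.1 hz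
    simp [hp.ne_zero, hroot]
  have h1 := Finset.card_le_card hsub
  rw [Finset.card_image_of_injective _ hinj, Finset.card_univ, Fintype.card_fin] at h1
  calc t ≤ _ := h1
    _ ≤ p.roots.card := Multiset.toFinset_card_le _
    _ ≤ p.natDegree := p.card_roots'
    _ = n := hpn

/-- The count for a complete irredundant family. -/
theorem aux_count {K R : Type u} [Field K] [IsAlgClosed K] [CharZero K] [Ring R] [Algebra K R]
    (J : Ideal R) (n : ℕ) (hn : 0 < n) (T : R →ₗ[K] K)
    (hJ2 : ∀ x ∈ J, ∀ r, x * r ∈ J) (hcyc : ∀ x y, T (x * y) = T (y * x))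
    (hTJ : ∀ x ∈ J, T x = 0) (hT1 : T 1 = n) (d : ℕ → R → K) (hd0 : ∀ a, d 0 a = 1)
    (hdrec : ∀ i : ℕ, 1 ≤ i → ∀ a : R,
      (i : K) * d i a = ∑ j ∈ Finset.Icc 1 i, (-1 : K) ^ (j - 1) * d (i - j) a * T (a ^ j))
    (hCH : ∀ a : R, ∑ i ∈ Finset.range (n + 1), ((-1 : K) ^ i * d i a) • a ^ (n - i) ∈ J)
    (t : ℕ) (V : Fin t → Type u) [∀ i, AddCommGroup (V i)] [∀ i, Module R (V i)]
    [∀ i, Module K (V i)] [∀ i, IsScalarTower K R (V i)] [∀ i, IsSimpleModule R (V i)]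
    (hV : ∀ i, ∀ z ∈ J, ∀ v : V i, z • v = 0)
    (hne : ∀ i j, i ≠ j → ¬ Nonempty (V i ≃ₗ[R] V j))
    (hcomp : ∀ (W : Type u) [AddCommGroup W] [Module R W], IsSimpleModule R W →
      (∀ z ∈ J, ∀ w : W, z • w = 0) → ∃ i, Nonempty (W ≃ₗ[R] V i)) (l : ℕ) :
    ((∃ y : Fin l → R, Matrix.det (Matrix.of fun i j => T (y i * y j)) ≠ 0) ↔
      l ≤ ∑ i, Module.finrank K (V i) ^ 2) ∧
    ((∃ y y' : Fin l → R, Matrix.det (Matrix.of fun i j => T (y i * y' j)) ≠ 0) ↔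
      l ≤ ∑ i, Module.finrank K (V i) ^ 2) := by
  have : ∀ i, Module.Finite K (V i) := fun i => aux_findim J n d hd0 hCH (V i) (hV i)
  let B : LinearMap.BilinForm K R := (LinearMap.mul K R).compr₂ T
  have hB : ∀ x y, B x y = T (x * y) := fun _ _ => rfl
  let Φ : R →ₗ[K] (∀ i, Module.End K (V i)) :=
    LinearMap.pi fun i => (Algebra.lsmul K K (V i)).toLinearMap
  have hΦa : ∀ x i (v : V i), Φ x i v = x • v := fun _ _ _ => rfl
  have hΦ : Function.Surjective Φ := by
    intro f
    obtain ⟨r, hr⟩ := aux_surj (K := K) V hne f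
    exact ⟨r, by ext i v; rw [hΦa, hr]⟩
  have hker : ∀ x, Φ x = 0 ↔ ∀ y, B x y = 0 := by
    intro x
    constructor
    · intro hx y
      rw [hB, hcyc]
      refine aux_kills_rad J n hn T hJ2 hTJ hT1 d hd0 hdrec hCH x ?_ y
      intro W _ _ hW hJW w
      obtain ⟨i, ⟨e⟩⟩ := hcomp W hW hJW
      apply e.injective
      rw [map_smul, map_zero, ← hΦa, hx]; rfl
    · intro hx
      ext i v
      rw [hΦa]
      exact aux_rad_kills J n T d hd0 hdrec hCH x (fun y => by rw [hcyc]; exact hx y) (V i) (hV i) v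
  have hdim : Module.finrank K (∀ i, Module.End K (V i)) = ∑ i, Module.finrank K (V i) ^ 2 := by
    rw [Module.finrank_pi_fintype]
    exact Finset.sum_congr rfl fun i _ => by rw [Module.finrank_linearMap, sq]
  rw [← hdim]
  exact aux_gram B (fun x y => hcyc x y) Φ hΦ hker l

/-- Restriction of scalars to `K`. -/
abbrev auxModule (K : Type v) [Field K] (R : Type u) [Ring R] [Algebra K R]
    (W : Type u) [AddCommGroup W] [Module R W] : Module K W :=
  Module.compHom W (algebraMap K R)

theorem aux_tower (K : Type v) [Field K] (R : Type u) [Ring R] [Algebra K R]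
    (W : Type u) [AddCommGroup W] [Module R W] :
    letI : Module K W := auxModule K R W
    IsScalarTower K R W := by
  letI : Module K W := auxModule K R W
  refine ⟨fun k r w => ?_⟩
  show (k • r) • w = algebraMap K R k • (r • w)
  rw [Algebra.smul_def, mul_smul]

/-- Existence of a complete irredundant family. -/
theorem aux_exists_family {K R : Type u} [Field K] [IsAlgClosed K] [CharZero K] [Ring R]
    [Algebra K R] (J : Ideal R) (n : ℕ) (d : ℕ → R → K) (hd0 : ∀ a, d 0 a = 1)
    (hCH : ∀ a : R, ∑ i ∈ Finset.range (n + 1), ((-1 : K) ^ i * d i a) • a ^ (n - i) ∈ J) :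
    ∃ (t : ℕ) (V : Fin t → ModRep R), (∀ i, IsSimpleModule R (V i).carrier) ∧
      (∀ i, ∀ z ∈ J, ∀ v : (V i).carrier, z • v = 0) ∧
      (∀ i j, i ≠ j → ¬ Nonempty ((V i).carrier ≃ₗ[R] (V j).carrier)) ∧
      (∀ (W : Type u) [AddCommGroup W] [Module R W], IsSimpleModule R W →
      (∀ z ∈ J, ∀ w : W, z • w = 0) → ∃ i, Nonempty (W ≃ₗ[R] (V i).carrier)) := by
  classical
  let P : ℕ → Prop := fun t => ∃ V : Fin t → ModRep R, (∀ i, IsSimpleModule R (V i).carrier) ∧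
      (∀ i, ∀ z ∈ J, ∀ v : (V i).carrier, z • v = 0) ∧
      (∀ i j, i ≠ j → ¬ Nonempty ((V i).carrier ≃ₗ[R] (V j).carrier))
  have hb : ∀ t, P t → t ≤ n := by
    rintro t ⟨V, h1, h2, h3⟩
    letI : ∀ i, Module K (V i).carrier := fun i => auxModule K R _
    have : ∀ i, IsScalarTower K R (V i).carrier := fun i => aux_tower K R _
    exact aux_bound J n d hd0 hCH t (fun i => (V i).carrier) h2 h3
  have h0 : P 0 := ⟨Fin.elim0, fun i => i.elim0, fun i => i.elim0, fun i => i.elim0⟩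
  have hP := Nat.findGreatest_spec (P := P) (Nat.zero_le n) h0
  have hmax : ¬ P (Nat.findGreatest P n + 1) := fun h => by
    have := Nat.le_findGreatest (hb _ h) h
    omega
  generalize Nat.findGreatest P n = t at hP hmax
  obtain ⟨V, h1, h2, h3⟩ := hP
  refine ⟨t, V, h1, h2, h3, fun W _ _ hW hJW => ?_⟩
  by_contra hno
  push Not at hno
  apply hmax
  refine ⟨Fin.cons ⟨W⟩ V, ?_, ?_, ?_⟩
  · intro i
    refine Fin.cases ?_ (fun i => ?_) i
    · exact hW
    · exact h1 i
  · intro i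
    refine Fin.cases ?_ (fun i => ?_) i
    · exact hJW
    · exact h2 i
  · intro i j
    refine Fin.cases ?_ (fun i => ?_) i <;> refine Fin.cases ?_ (fun j => ?_) j
    · intro h; exact absurd rfl h
    · rintro _ ⟨e⟩; exact (hno j).false e
    · rintro _ ⟨e⟩; exact (hno i).false e.symm
    · intro h; exact h3 i j (fun hij => h (by rw [hij]))

/-- Everything at a single maximal ideal. -/
theorem aux_local
    {K C R : Type u} [Field K] [IsAlgClosed K] [CharZero K]
    [CommRing C] [Ring R] [Algebra K C] [Algebra K R] [Algebra C R] [IsScalarTower K C R]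
    [Algebra.FiniteType K R]
    (n : ℕ) (hn : 0 < n)
    (tr : R →ₗ[C] C) (hcyc : ∀ x y : R, tr (x * y) = tr (y * x))
    (htr1 : tr 1 = (n : C))
    (c : ℕ → R → C)
    (hc0 : ∀ a : R, c 0 a = 1)
    (hcrec : ∀ i : ℕ, 1 ≤ i → ∀ a : R,
      (i : C) * c i a = ∑ j ∈ Finset.Icc 1 i, (-1 : C) ^ (j - 1) * c (i - j) a * tr (a ^ j))
    (hCH : ∀ a : R, ∑ i ∈ Finset.range (n + 1), ((-1 : C) ^ i * c i a) • a ^ (n - i) = 0)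
    (m : Ideal C) (hm : m.IsMaximal) :
    ∃ J : Ideal R, (∀ (W : Type u) [AddCommGroup W] [Module R W],
        (∀ z ∈ J, ∀ w : W, z • w = 0) ↔ (∀ z : C, z ∈ m → ∀ w : W, algebraMap C R z • w = 0)) ∧
      (∀ (W : Type u) [AddCommGroup W] [Module R W], IsSimpleModule R W →
        (∀ z ∈ J, ∀ w : W, z • w = 0) → finDimOver K R W) ∧
      (∃ (t : ℕ) (V : Fin t → ModRep R), (∀ i, IsSimpleModule R (V i).carrier) ∧
      (∀ i, ∀ z ∈ J, ∀ v : (V i).carrier, z • v = 0) ∧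
      (∀ i j, i ≠ j → ¬ Nonempty ((V i).carrier ≃ₗ[R] (V j).carrier)) ∧
      (∀ (W : Type u) [AddCommGroup W] [Module R W], IsSimpleModule R W →
      (∀ z ∈ J, ∀ w : W, z • w = 0) → ∃ i, Nonempty (W ≃ₗ[R] (V i).carrier))) ∧
      (∀ (t : ℕ) (V : Fin t → ModRep R), (∀ i, IsSimpleModule R (V i).carrier) →
      (∀ i, ∀ z ∈ J, ∀ v : (V i).carrier, z • v = 0) →
      (∀ i j, i ≠ j → ¬ Nonempty ((V i).carrier ≃ₗ[R] (V j).carrier)) →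
      (∀ (W : Type u) [AddCommGroup W] [Module R W], IsSimpleModule R W →
      (∀ z ∈ J, ∀ w : W, z • w = 0) → ∃ i, Nonempty (W ≃ₗ[R] (V i).carrier)) →
      ∀ l : ℕ, (discIdeal l tr ≤ m ↔ ∑ i, (repDim K (V i)) ^ 2 < l) ∧
        (mdiscIdeal l tr ≤ m ↔ ∑ i, (repDim K (V i)) ^ 2 < l)) := by
  have hCn : Nontrivial C := by
    by_contra h
    rw [not_nontrivial_iff_subsingleton] at h
    exact hm.ne_top (Subsingleton.elim _ _)
  have hint : ∀ a : R, ∃ p : Polynomial C, p.Monic ∧ p.natDegree = n ∧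
      Polynomial.aeval a p = 0 := by
    intro a
    obtain ⟨p, h1, h2, h3⟩ := aux_monic n (fun i => (-1 : C) ^ i * c i a) (by simp [hc0]) a
    exact ⟨p, h1, h2, by rw [h3]; exact hCH a⟩
  have hbij := aux_residue (K := K) n hn tr htr1 hint m
  let φ : C →ₐ[K] K := ((AlgEquiv.ofBijective (Algebra.ofId K (C ⧸ m)) hbij).symm :
    (C ⧸ m) →ₐ[K] K).comp (Ideal.Quotient.mkₐ K m)
  have hφ : ∀ z, φ z = 0 ↔ z ∈ m := by
    intro z
    rw [← Ideal.Quotient.eq_zero_iff_mem]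
    show (AlgEquiv.ofBijective (Algebra.ofId K (C ⧸ m)) hbij).symm (Ideal.Quotient.mk m z) = 0 ↔ _
    rw [map_eq_zero_iff _ (AlgEquiv.injective _)]
  let J : Ideal R := m.map (algebraMap C R)
  have hJ : ∀ z ∈ m, ∀ r : R, z • r ∈ J := by
    intro z hz r
    rw [Algebra.smul_def, Algebra.commutes]
    exact J.mul_mem_left _ (Ideal.mem_map_of_mem _ hz)
  have hJind : ∀ x ∈ J, ∀ Q : R → Prop, (∀ z ∈ m, ∀ r : R, Q (z • r)) → Q 0 →
      (∀ x y, Q x → Q y → Q (x + y)) → Q x := by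
    intro x hx Q h1 h0 ha
    have := Submodule.span_induction (p := fun x _ => ∀ r : R, Q (r * x)) ?_ ?_ ?_ ?_ hx 1
    · simpa using this
    · rintro _ ⟨z, hz, rfl⟩ r
      rw [← Algebra.commutes, ← Algebra.smul_def]
      exact h1 z hz r
    · intro r; rwa [mul_zero]
    · intro x y _ _ hx hy r
      rw [mul_add]; exact ha _ _ (hx r) (hy r)
    · intro a x _ hx r
      rw [smul_eq_mul, ← mul_assoc]; exact hx _
  have hJ2 : ∀ x ∈ J, ∀ r, x * r ∈ J := by
    intro x hx r
    refine hJind x hx (fun x => x * r ∈ J) ?_ ?_ ?_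
    · intro z hz s
      rw [smul_mul_assoc]; exact hJ z hz _
    · simp
    · intro x y hx hy
      rw [add_mul]; exact J.add_mem hx hy
  let T : R →ₗ[K] K := φ.toLinearMap ∘ₗ (tr.restrictScalars K)
  have hT : ∀ x, T x = φ (tr x) := fun _ => rfl
  have hTJ : ∀ x ∈ J, T x = 0 := by
    intro x hx
    refine hJind x hx (fun x => T x = 0) ?_ (map_zero T) ?_
    · intro z hz s
      rw [hT, map_smul, smul_eq_mul, map_mul, (hφ z).2 hz, zero_mul]
    · intro x y hx hy
      rw [map_add, hx, hy, add_zero]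
  let d : ℕ → R → K := fun i a => φ (c i a)
  have hd0 : ∀ a, d 0 a = 1 := fun a => by simp [d, hc0]
  have hdrec : ∀ i : ℕ, 1 ≤ i → ∀ a : R,
      (i : K) * d i a = ∑ j ∈ Finset.Icc 1 i, (-1 : K) ^ (j - 1) * d (i - j) a * T (a ^ j) := by
    intro i hi a
    have := congrArg φ (hcrec i hi a)
    simpa [d, hT] using this
  have hdCH : ∀ a : R, ∑ i ∈ Finset.range (n + 1), ((-1 : K) ^ i * d i a) • a ^ (n - i) ∈ J := by
    intro a
    rw [← sub_zero (∑ i ∈ Finset.range (n + 1), ((-1 : K) ^ i * d i a) • a ^ (n - i)), ← hCH a,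
      ← Finset.sum_sub_distrib]
    refine J.sum_mem fun i _ => ?_
    rw [← algebraMap_smul C ((-1 : K) ^ i * d i a), ← sub_smul]
    apply hJ
    rw [← hφ]
    simp [d]
  have hT1 : T 1 = n := by rw [hT, htr1, map_natCast]
  have hTcyc : ∀ x y, T (x * y) = T (y * x) := fun x y => by rw [hT, hT, hcyc]
  refine ⟨J, ?_, ?_, aux_exists_family J n d hd0 hdCH, ?_⟩
  · intro W _ _
    constructor
    · intro h z hz w
      exact h _ (Ideal.mem_map_of_mem _ hz) w
    · intro h x hx
      refine hJind x hx (fun x => ∀ w : W, x • w = 0) ?_ ?_ ?_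
      · intro z hz r w
        rw [Algebra.smul_def, mul_smul, h z hz]
      · intro w; rw [zero_smul]
      · intro x y hx hy w
        rw [add_smul, hx, hy, add_zero]
  · intro W _ _ hW hJW
    letI : Module K W := auxModule K R W
    have : IsScalarTower K R W := aux_tower K R W
    exact aux_findim J n d hd0 hdCH W hJW
  · intro t V h1 h2 h3 h4 l
    letI : ∀ i, Module K (V i).carrier := fun i => auxModule K R _
    have : ∀ i, IsScalarTower K R (V i).carrier := fun i => aux_tower K R _
    have key := aux_count J n hn T hJ2 hTcyc hTJ hT1 d hd0 hdrec hdCH t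
      (fun i => (V i).carrier) h2 h3 h4 l
    have hdet : ∀ y y' : Fin l → R, (Matrix.det (Matrix.of fun i j => tr (y i * y' j)) ∈ m ↔
        Matrix.det (Matrix.of fun i j => T (y i * y' j)) = 0) := by
      intro y y'
      rw [← hφ, AlgHom.map_det]
      rfl
    have hsum : ∑ i, (repDim K (V i)) ^ 2 = ∑ i, Module.finrank K (V i).carrier ^ 2 := rfl
    rw [hsum]
    constructor
    · rw [← not_le, ← key.1, not_exists, discIdeal, Ideal.span_le]
      constructor
      · intro h y hy
        exact hy ((hdet y y).1 (h ⟨y, rfl⟩))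
      · rintro h _ ⟨y, rfl⟩
        exact (hdet y y).2 (not_not.1 (h y))
    · rw [← not_le, ← key.2, not_exists, mdiscIdeal, Ideal.span_le]
      constructor
      · rintro h y ⟨y', hy⟩
        exact hy ((hdet y y').1 (h ⟨y, y', rfl⟩))
      · rintro h _ ⟨y, y', rfl⟩
        exact (hdet y y').2 (by_contra fun hne => h y ⟨y', hne⟩)


/-- **Theorem 4.1(b) of Brown–Yakimov**: let `R` be a Cayley–Hamilton algebra of degree `n`
with trace `tr : R → C` over an algebraically closed field `K` of characteristic `0`. Then
for every positive integer `ℓ`, the zero sets of the `ℓ`-discriminant ideal and the modified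
`ℓ`-discriminant ideal of `R` over `C` coincide and equal the set of maximal ideals `m` of
`C` for which `∑_{V ∈ Irr_m(R)} (dim_K V)² < ℓ`, the sum being over a complete irredundant
family of finite-dimensional simple `R`-modules annihilated by `m`. -/
theorem cayley_hamilton_discriminant_zero_locus
    {K C R : Type u} [Field K] [IsAlgClosed K] [CharZero K]
    [CommRing C] [Ring R] [Algebra K C] [Algebra K R] [Algebra C R] [IsScalarTower K C R]
    (hinj : Function.Injective (algebraMap C R))
    [Algebra.FiniteType K R]
    (n : ℕ) (hn : 0 < n)
    (tr : R →ₗ[C] C) (htr0 : tr ≠ 0) (hcyc : ∀ x y : R, tr (x * y) = tr (y * x))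
    (htr1 : tr 1 = (n : C))
    -- the Cayley–Hamilton identity of degree `n`: the characteristic coefficients
    -- `c i a = ĉ_i(a)` are determined from the Newton identities by the power sums
    -- `tr (a^j)`, and every `a : R` satisfies its characteristic polynomial
    (c : ℕ → R → C)
    (hc0 : ∀ a : R, c 0 a = 1)
    (hcrec : ∀ i : ℕ, 1 ≤ i → ∀ a : R,
      (i : C) * c i a = ∑ j ∈ Finset.Icc 1 i, (-1 : C) ^ (j - 1) * c (i - j) a * tr (a ^ j))
    (hCH : ∀ a : R, ∑ i ∈ Finset.range (n + 1), ((-1 : C) ^ i * c i a) • a ^ (n - i) = 0)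
    (ℓ : ℕ) (hℓ : 0 < ℓ) :
    maxZeroLocus (mdiscIdeal ℓ tr) = maxZeroLocus (discIdeal ℓ tr) ∧
    maxZeroLocus (discIdeal ℓ tr) =
      { m : Ideal C | m.IsMaximal ∧
        ∃ (t : ℕ) (V : Fin t → ModRep R),
          (∀ i, IsSimpleModule R (V i).carrier) ∧
          (∀ i, repFinDim K (V i)) ∧
          (∀ i, killedBy (V i) m) ∧
          (∀ i j, i ≠ j → ¬ Nonempty ((V i).carrier ≃ₗ[R] (V j).carrier)) ∧
          (∀ (W : Type u) [AddCommGroup W] [Module R W], IsSimpleModule R W →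
            finDimOver K R W →
            (∀ z : C, z ∈ m → ∀ w : W, algebraMap C R z • w = 0) →
            ∃ i, Nonempty (W ≃ₗ[R] (V i).carrier)) ∧
          (∑ i, (repDim K (V i)) ^ 2) < ℓ } := by
  have hloc := fun m hm => aux_local (K := K) n hn tr hcyc htr1 c hc0 hcrec hCH m hm
  constructor
  · ext m
    refine and_congr_right fun hm => ?_
    obtain ⟨J, -, -, ⟨t, V, h1, h2, h3, h4⟩, h5⟩ := hloc m hm
    have h6 := h5 t V h1 h2 h3 h4 ℓ
    exact h6.2.trans h6.1.symm
  · ext m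
    refine and_congr_right fun hm => ?_
    obtain ⟨J, hJ, hfd, ⟨t, V, h1, h2, h3, h4⟩, h5⟩ := hloc m hm
    constructor
    · intro h
      refine ⟨t, V, h1, fun i => hfd _ (h1 i) (h2 i), fun i => (hJ _).1 (h2 i), h3, ?_,
        (h5 t V h1 h2 h3 h4 ℓ).1.1 h⟩
      intro W _ _ hW _ hk
      exact h4 W hW ((hJ W).2 hk)
    · rintro ⟨t, V, h1, h2, h3, h4, h6, h7⟩
      refine (h5 t V h1 (fun i => (hJ _).2 (h3 i)) h4 ?_ ℓ).1.2 h7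
      intro W _ _ hW hk
      exact h6 W hW (hfd W hW hk) ((hJ W).1 hk)
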